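/- arXiv:2311.10333 — 6 statements merged into one kernel-verified Lean document; each statement's English description precedes it below -/
import Mathlib

section
/- Let n ≥ 1 be an integer and let f : ℝ → ℝ be continuous and 2π-periodic, not identically zero, such that ∫₀^{2π} f(θ)·cos(kθ) dθ = 0 and ∫₀^{2π} f(θ)·sin(kθ) dθ = 0 for every integer k with 0 ≤ k < n (so the Fourier series of f starts no sooner than order n). Then f has at least 2n distinct zeros in the interval [0, 2π). -/
section
open Real Set Filter Topology

def SH_LS (h : ℝ → ℝ) (x : ℝ) : Prop :=
  (∀ᶠ y in 𝓝 x, 0 ≤ h y) ∨ (∀ᶠ y in 𝓝 x, h y ≤ 0)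

theorem SH_LS.mul {f g : ℝ → ℝ} {x : ℝ} (hf : SH_LS f x) (hg : SH_LS g x) :
    SH_LS (fun y => f y * g y) x := by
  rcases hf with hf | hf <;> rcases hg with hg | hg
  · left; filter_upwards [hf, hg] with y h1 h2 using mul_nonneg h1 h2
  · right; filter_upwards [hf, hg] with y h1 h2 using mul_nonpos_of_nonneg_of_nonpos h1 h2
  · right; filter_upwards [hf, hg] with y h1 h2 using mul_nonpos_of_nonpos_of_nonneg h1 h2
  · left; filter_upwards [hf, hg] with y h1 h2 using mul_nonneg_of_nonpos_of_nonpos h1 h2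

theorem SH_LS.of_ne {f : ℝ → ℝ} {x : ℝ} (hf : Continuous f) (hx : f x ≠ 0) : SH_LS f x := by
  rcases lt_or_gt_of_ne hx with h | h
  · right
    filter_upwards [hf.continuousAt.eventually (gt_mem_nhds h)] with y hy using hy.le
  · left
    filter_upwards [hf.continuousAt.eventually (lt_mem_nhds h)] with y hy using hy.le

theorem SH_sign_const {f : ℝ → ℝ} (hf : Continuous f) {s : Set ℝ} (hs : IsPreconnected s)
    (h0 : ∀ y ∈ s, f y ≠ 0) : (∀ y ∈ s, 0 ≤ f y) ∨ (∀ y ∈ s, f y ≤ 0) := by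
  by_contra! hcon
  obtain ⟨⟨a, ha, ha'⟩, ⟨b, hb, hb'⟩⟩ := hcon
  have := hs.intermediate_value ha hb hf.continuousOn ⟨ha'.le, hb'.le⟩
  obtain ⟨c, hc, hc0⟩ := this
  exact h0 c hc hc0

theorem SH_lr {f : ℝ → ℝ} (hf : Continuous f) {x : ℝ} (h0 : ∀ᶠ y in 𝓝[≠] x, f y ≠ 0)
    (hx : f x = 0) :
    SH_LS f x ∨ SH_LS (fun y => (y - x) * f y) x := by
  rw [eventually_nhdsWithin_iff, Metric.eventually_nhds_iff] at h0
  obtain ⟨ε, hε, h0⟩ := h0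
  have hL := SH_sign_const hf (s := Ioo (x - ε) x) isPreconnected_Ioo (fun y hy => h0 (by
    rw [Real.dist_eq, abs_lt]; constructor <;> linarith [hy.1, hy.2]) (ne_of_lt hy.2))
  have hR := SH_sign_const hf (s := Ioo x (x + ε)) isPreconnected_Ioo (fun y hy => h0 (by
    rw [Real.dist_eq, abs_lt]; constructor <;> linarith [hy.1, hy.2]) (ne_of_gt hy.1))
  have hn : ∀ᶠ y in 𝓝 x, y ∈ Ioo (x - ε) (x + ε) := Ioo_mem_nhds (by linarith) (by linarith)
  rcases hL with hL | hL <;> rcases hR with hR | hR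
  · left; left
    filter_upwards [hn] with y hy
    rcases lt_trichotomy y x with h | h | h
    · exact hL y ⟨hy.1, h⟩
    · rw [h, hx]
    · exact hR y ⟨h, hy.2⟩
  · right; right
    filter_upwards [hn] with y hy
    rcases lt_trichotomy y x with h | h | h
    · have := hL y ⟨hy.1, h⟩
      nlinarith
    · rw [h, hx]; simp
    · have := hR y ⟨h, hy.2⟩
      nlinarith
  · right; left
    filter_upwards [hn] with y hy
    rcases lt_trichotomy y x with h | h | h
    · have := hL y ⟨hy.1, h⟩
      nlinarith
    · rw [h, hx]; simp
    · have := hR y ⟨h, hy.2⟩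
      nlinarith
  · left; right
    filter_upwards [hn] with y hy
    rcases lt_trichotomy y x with h | h | h
    · exact hL y ⟨hy.1, h⟩
    · rw [h, hx]
    · exact hR y ⟨h, hy.2⟩

theorem SH_sinLS (x : ℝ) : SH_LS (fun y => (y - x) * sin ((y - x) / 2)) x := by
  left
  have hn : ∀ᶠ y in 𝓝 x, y ∈ Ioo (x - 1) (x + 1) := Ioo_mem_nhds (by linarith) (by linarith)
  filter_upwards [hn] with y hy
  have hpi := Real.pi_gt_three
  rcases le_total x y with h | h
  · exact mul_nonneg (by linarith)
      (sin_nonneg_of_nonneg_of_le_pi (by linarith) (by linarith [hy.2]))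
  · exact mul_nonneg_of_nonpos_of_nonpos (by linarith)
      (sin_nonpos_of_nonpos_of_neg_pi_le (by linarith) (by linarith [hy.1]))

theorem SH_cancel {f g : ℝ → ℝ} {x : ℝ} (hx : f x = 0)
    (hf : SH_LS (fun y => (y - x) * f y) x) (hg : SH_LS (fun y => (y - x) * g y) x) :
    SH_LS (fun y => f y * g y) x := by
  rcases hf.mul hg with h | h
  · left
    filter_upwards [h] with y hy
    by_cases hyx : y = x
    · rw [hyx, hx]; simp
    · have : 0 < (y - x) ^ 2 := by have := sub_ne_zero.mpr hyx; positivity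
      by_contra! hc
      nlinarith [mul_pos_of_neg_of_neg hc (neg_neg_of_pos this)]
  · right
    filter_upwards [h] with y hy
    by_cases hyx : y = x
    · rw [hyx, hx]; simp
    · have : 0 < (y - x) ^ 2 := by have := sub_ne_zero.mpr hyx; positivity
      by_contra! hc
      nlinarith [mul_pos hc this]

theorem SH_global {h : ℝ → ℝ} (hh : Continuous h) (hls : ∀ x, SH_LS h x)
    (h0 : ∀ x, ∀ᶠ y in 𝓝[≠] x, h y ≠ 0) : (∀ x, 0 ≤ h x) ∨ (∀ x, h x ≤ 0) := by
  have hA : IsOpen {x | ∀ᶠ y in 𝓝 x, 0 ≤ h y} := isOpen_setOfPred_eventually_nhds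
  have hB : IsOpen {x | ∀ᶠ y in 𝓝 x, h y ≤ 0} := isOpen_setOfPred_eventually_nhds
  by_contra! hcon
  obtain ⟨⟨a, ha⟩, ⟨b, hb⟩⟩ := hcon
  have haB : ∀ᶠ y in 𝓝 a, h y ≤ 0 := by
    filter_upwards [hh.continuousAt.eventually (gt_mem_nhds ha)] with y hy using hy.le
  have hbA : ∀ᶠ y in 𝓝 b, 0 ≤ h y := by
    filter_upwards [hh.continuousAt.eventually (lt_mem_nhds hb)] with y hy using hy.le
  obtain ⟨x, -, hx1, hx2⟩ := (isPreconnected_univ (α := ℝ)) _ _ hA hB (fun x _ => hls x)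
    ⟨b, trivial, hbA⟩ ⟨a, trivial, haB⟩
  have h1 : ∀ᶠ y in 𝓝[≠] x, h y = 0 := by
    apply eventually_nhdsWithin_of_eventually_nhds
    filter_upwards [hx1, hx2] with y h1 h2 using le_antisymm h2 h1
  obtain ⟨y, h2, h3⟩ := (h1.and (h0 x)).exists
  exact h3 h2

theorem SH_rep (y : ℝ) : ∃ z ∈ Ico (0:ℝ) (2 * π), ∃ k : ℤ, y = z + k * (2 * π) := by
  obtain ⟨m, hm, -⟩ := existsUnique_add_zsmul_mem_Ico (two_pi_pos) y 0
  refine ⟨y + m • (2 * π), by simpa using hm, -m, ?_⟩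
  simp

theorem SH_perk {f : ℝ → ℝ} (hper : ∀ θ : ℝ, f (θ + 2 * π) = f θ) (k : ℤ) (y : ℝ) :
    f (y + k * (2 * π)) = f y :=
  (Function.Periodic.int_mul (c := 2 * π) hper k) y

theorem SH_isol {f : ℝ → ℝ} (hper : ∀ θ : ℝ, f (θ + 2 * π) = f θ)
    (hfin : {z | z ∈ Ico (0:ℝ) (2 * π) ∧ f z = 0}.Finite) (x : ℝ) :
    ∀ᶠ y in 𝓝[≠] x, f y ≠ 0 := by
  have hp := two_pi_pos
  obtain ⟨x0, hx0, k0, hk0⟩ := SH_rep x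
  have hF : ((fun q : ℝ × ℤ => q.1 + q.2 * (2 * π)) ''
      ({z | z ∈ Ico (0:ℝ) (2 * π) ∧ f z = 0} ×ˢ Icc (k0 - 1) (k0 + 1))).Finite :=
    (hfin.prod (Set.finite_Icc _ _)).image _
  have hN := (hF.subset (sdiff_subset (t := {x}))).isClosed.isOpen_compl.mem_nhds
    (show x ∈ _ by simp)
  rw [eventually_nhdsWithin_iff]
  have hn : ∀ᶠ y in 𝓝 x, y ∈ Ioo (x - 2 * π) (x + 2 * π) :=
    Ioo_mem_nhds (by linarith) (by linarith)
  filter_upwards [hN, hn] with y hy hy2 hyx hfy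
  apply hy
  refine ⟨?_, hyx⟩
  obtain ⟨z, hz, k, hk⟩ := SH_rep y
  refine ⟨(z, k), ⟨⟨hz, ?_⟩, ?_⟩, hk.symm⟩
  · rw [← SH_perk hper k z, ← hk, hfy]
  · have h1 : ((k0 - 2 : ℤ) : ℝ) < k := by
      push_cast
      have := hy2.1; have := hz.2; have := hx0.1
      by_contra! hc
      nlinarith
    have h2 : (k : ℝ) < ((k0 + 2 : ℤ) : ℝ) := by
      push_cast
      have := hy2.2; have := hz.1; have := hx0.2
      by_contra! hc
      nlinarith
    have h1 := Int.cast_lt.mp h1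
    have h2 := Int.cast_lt.mp h2
    constructor <;> dsimp only <;> omega

def SH_W (c : ℕ) : Submodule ℝ (ℝ → ℝ) :=
  Submodule.span ℝ {g | ∃ j : ℕ, j ≤ c ∧ ∃ φ : ℝ,
    g = fun θ => sin (((c : ℝ) - 2 * j) / 2 * θ + φ)}

theorem SH_W_mul (c : ℕ) (a : ℝ) (g : ℝ → ℝ) (hg : g ∈ SH_W c) :
    (fun θ => sin ((θ - a) / 2) * g θ) ∈ SH_W (c + 1) := by
  induction hg using Submodule.span_induction with
  | mem g hg =>
    obtain ⟨j, hj, φ, rfl⟩ := hg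
    have h1 : (fun θ => sin ((((c + 1 : ℕ) : ℝ) - 2 * ((j + 1 : ℕ) : ℝ)) / 2 * θ + (φ + a / 2 + π / 2)))
        ∈ SH_W (c + 1) := Submodule.subset_span ⟨j + 1, by omega, _, rfl⟩
    have h2 : (fun θ => sin ((((c + 1 : ℕ) : ℝ) - 2 * (j : ℝ)) / 2 * θ + (φ - a / 2 + π / 2)))
        ∈ SH_W (c + 1) := Submodule.subset_span ⟨j, by omega, _, rfl⟩
    have := (SH_W (c + 1)).smul_mem (1/2 : ℝ) ((SH_W (c + 1)).sub_mem h1 h2)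
    convert this using 1
    funext θ
    simp only [Pi.smul_apply, Pi.sub_apply, smul_eq_mul]
    rw [← add_assoc _ _ (π / 2), ← add_assoc _ _ (π / 2), sin_add_pi_div_two, sin_add_pi_div_two]
    have e1 : (((c + 1 : ℕ) : ℝ) - 2 * ((j + 1 : ℕ) : ℝ)) / 2 * θ + (φ + a / 2)
      = (((c : ℝ) - 2 * j) / 2 * θ + φ) - (θ - a) / 2 := by push_cast; ring
    have e2 : (((c + 1 : ℕ) : ℝ) - 2 * (j : ℝ)) / 2 * θ + (φ - a / 2)
      = (((c : ℝ) - 2 * j) / 2 * θ + φ) + (θ - a) / 2 := by push_cast; ring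
    rw [e1, e2, cos_sub, cos_add _ ((θ - a) / 2)]
    ring
  | zero =>
    convert (SH_W (c + 1)).zero_mem using 1
    funext θ; simp
  | add x y _ _ hx hy =>
    convert (SH_W (c + 1)).add_mem hx hy using 1
    funext θ; simp [mul_add]
  | smul r x _ hx =>
    convert (SH_W (c + 1)).smul_mem r hx using 1
    funext θ; simp; ring

theorem SH_prod_mem (T : Finset ℝ) : (fun θ => ∏ a ∈ T, sin ((θ - a) / 2)) ∈ SH_W T.card := by
  induction T using Finset.induction_on with
  | empty =>
    apply Submodule.subset_span
    refine ⟨0, le_rfl, π / 2, ?_⟩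
    funext θ; simp
  | insert a s ha ih =>
    rw [Finset.card_insert_of_notMem ha]
    convert SH_W_mul _ a _ ih using 1
    funext θ
    rw [Finset.prod_insert ha]

theorem SH_orth (n : ℕ) (f : ℝ → ℝ) (hc : Continuous f)
    (hcos : ∀ k : ℕ, k < n → (∫ θ in (0:ℝ)..(2 * π), f θ * cos (k * θ)) = 0)
    (hsin : ∀ k : ℕ, k < n → (∫ θ in (0:ℝ)..(2 * π), f θ * sin (k * θ)) = 0)
    (m : ℕ) (hm : m < n) (g : ℝ → ℝ) (hg : g ∈ SH_W (m + m)) :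
    Continuous g ∧ (∫ θ in (0:ℝ)..(2 * π), f θ * g θ) = 0 := by
  induction hg using Submodule.span_induction with
  | mem g hg =>
    obtain ⟨j, hj, φ, rfl⟩ := hg
    refine ⟨by fun_prop, ?_⟩
    have key : ∀ (k : ℕ) (φ : ℝ), k < n →
        (∫ θ in (0:ℝ)..(2 * π), f θ * sin (k * θ + φ)) = 0 := by
      intro k φ hk
      have : ∀ θ, f θ * sin (k * θ + φ) =
        cos φ * (f θ * sin (k * θ)) + sin φ * (f θ * cos (k * θ)) := by
        intro θ; rw [sin_add]; ring
      simp_rw [this]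
      rw [intervalIntegral.integral_add (Continuous.intervalIntegrable (by fun_prop) _ _)
        (Continuous.intervalIntegrable (by fun_prop) _ _),
        intervalIntegral.integral_const_mul, intervalIntegral.integral_const_mul,
        hcos k hk, hsin k hk]
      simp
    rcases le_total j m with h | h
    · refine Eq.trans (intervalIntegral.integral_congr fun θ _ => ?_) (key (m - j) φ (by omega))
      have e : (((m + m : ℕ) : ℝ) - 2 * j) / 2 * θ + φ = ((m - j : ℕ) : ℝ) * θ + φ := by
        rw [Nat.cast_sub h]; push_cast; ring
      simp only [e]
    · have h2 := key (j - m) (-φ) (by omega)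
      rw [← neg_eq_zero, ← intervalIntegral.integral_neg] at h2
      refine Eq.trans (intervalIntegral.integral_congr fun θ _ => ?_) h2
      have e : (((m + m : ℕ) : ℝ) - 2 * j) / 2 * θ + φ = -(((j - m : ℕ) : ℝ) * θ + -φ) := by
        rw [Nat.cast_sub h]; push_cast; ring
      simp only [e, sin_neg, mul_neg]
  | zero => exact ⟨continuous_const, by simp⟩
  | add x y _ _ hx hy =>
    refine ⟨hx.1.add hy.1, ?_⟩
    have h1 := hx.1
    have h2 := hy.1
    simp_rw [Pi.add_apply, mul_add]
    rw [intervalIntegral.integral_add (Continuous.intervalIntegrable (by fun_prop) _ _)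
        (Continuous.intervalIntegrable (by fun_prop) _ _), hx.2, hy.2, add_zero]
  | smul r x _ hx =>
    refine ⟨hx.1.const_smul r, ?_⟩
    simp_rw [Pi.smul_apply, smul_eq_mul, mul_left_comm _ r]
    rw [intervalIntegral.integral_const_mul, hx.2, mul_zero]

theorem SH_sin_shift (a y : ℝ) (k : ℤ) :
    sin ((y - a) / 2) = (-1) ^ k * sin ((y - (a + k * (2 * π))) / 2) := by
  have : (y - (a + k * (2 * π))) / 2 = (y - a) / 2 - k * π := by ring
  rw [this, sin_sub_int_mul_pi, ← mul_assoc, ← mul_zpow]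
  simp

theorem SH_sin_zero {a y : ℝ} (h : sin ((y - a) / 2) = 0) : ∃ k : ℤ, y = a + k * (2 * π) := by
  obtain ⟨k, hk⟩ := sin_eq_zero_iff.mp h
  exact ⟨k, by linarith⟩

theorem SH_main (n : ℕ) (f : ℝ → ℝ) (hc : Continuous f)
    (hper : ∀ θ : ℝ, f (θ + 2 * π) = f θ)
    (hcos : ∀ k : ℕ, k < n → (∫ θ in (0:ℝ)..(2 * π), f θ * cos (k * θ)) = 0)
    (hsin : ∀ k : ℕ, k < n → (∫ θ in (0:ℝ)..(2 * π), f θ * sin (k * θ)) = 0)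
    (hfin : {z | z ∈ Ico (0:ℝ) (2 * π) ∧ f z = 0}.Finite) : 2 * n ≤ hfin.toFinset.card := by
  classical
  by_contra! hlt
  set Z := hfin.toFinset with hZ
  have hisol := SH_isol hper hfin
  have memZ : ∀ z, z ∈ Z ↔ z ∈ Ico (0:ℝ) (2 * π) ∧ f z = 0 := by intro z; simp [hZ]
  set T := Z.filter (fun a => ¬ SH_LS f a) with hT
  have hTcard : T.card ≤ Z.card := Finset.card_filter_le _ _
  have memT : ∀ a ∈ T, a ∈ Ico (0:ℝ) (2 * π) ∧ f a = 0 ∧ ¬ SH_LS f a := by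
    intro a ha
    rw [hT, Finset.mem_filter, memZ] at ha
    exact ⟨ha.1.1, ha.1.2, ha.2⟩
  set g : ℝ → ℝ := fun θ => ∏ a ∈ T, sin ((θ - a) / 2) with hg
  have hgc : Continuous g := by fun_prop
  have hLSshift : ∀ (a : ℝ) (k : ℤ), SH_LS f a → SH_LS f (a + k * (2 * π)) := by
    intro a k h
    have ht : Tendsto (fun y => y + ((-k : ℤ) : ℝ) * (2 * π)) (𝓝 (a + k * (2 * π))) (𝓝 a) := by
      have : Continuous (fun y => y + ((-k : ℤ) : ℝ) * (2 * π)) := by fun_prop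
      have h := this.tendsto (a + k * (2 * π))
      convert h using 2
      push_cast; ring
    rcases h with h | h
    · left; filter_upwards [ht.eventually h] with y hy
      rwa [SH_perk hper] at hy
    · right; filter_upwards [ht.eventually h] with y hy
      rwa [SH_perk hper] at hy
  have hg0 : ∀ y, f y ≠ 0 → g y ≠ 0 := by
    intro y hy
    rw [hg]
    refine Finset.prod_ne_zero_iff.mpr fun a ha h0 => ?_
    obtain ⟨k, hk⟩ := SH_sin_zero h0
    apply hy
    rw [hk, SH_perk hper]
    exact (memT a ha).2.1
  have hls : ∀ x, SH_LS (fun y => f y * g y) x := by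
    intro x
    obtain ⟨a, ha, k, hk⟩ := SH_rep x
    by_cases haT : a ∈ T
    · obtain ⟨-, hfa, hnls⟩ := memT a haT
      have hfx : f x = 0 := by rw [hk, SH_perk hper, hfa]
      have hnlsx : ¬ SH_LS f x := by
        intro h
        apply hnls
        have := hLSshift x (-k) h
        convert this using 1
        rw [hk]; push_cast; ring
      have h1 := (SH_lr hc (hisol x) hfx).resolve_left hnlsx
      have h2 : SH_LS (fun y => (y - x) * sin ((y - a) / 2)) x := by
        have h3 := (SH_LS.of_ne (f := fun _ : ℝ => (-1 : ℝ) ^ k) (x := x) continuous_const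
          (zpow_ne_zero _ (by norm_num))).mul (SH_sinLS x)
        convert h3 using 2 with y
        rw [SH_sin_shift a y k, ← hk]; ring
      have h4 := SH_cancel hfx h1 h2
      have h5 : SH_LS (fun y => ∏ b ∈ T.erase a, sin ((y - b) / 2)) x := by
        apply SH_LS.of_ne (by fun_prop)
        refine Finset.prod_ne_zero_iff.mpr fun b hb h0 => ?_
        obtain ⟨l, hl⟩ := SH_sin_zero h0
        rw [Finset.mem_erase] at hb
        have hb2 := (memT b hb.2).1
        apply hb.1
        have hp := two_pi_pos
        have e : b - a = ((k - l : ℤ) : ℝ) * (2 * π) := by push_cast; linarith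
        have l1 : ((k - l : ℤ) : ℝ) < ((1 : ℤ) : ℝ) := by
          rw [Int.cast_one]; by_contra! hcc; nlinarith [hb2.2, ha.1]
        have l2 : ((-1 : ℤ) : ℝ) < ((k - l : ℤ) : ℝ) := by
          rw [Int.cast_neg, Int.cast_one]; by_contra! hcc; nlinarith [hb2.1, ha.2]
        have l1 := Int.cast_lt.mp l1
        have l2 := Int.cast_lt.mp l2
        have : k - l = 0 := by omega
        rw [this] at e
        simp at e
        linarith
      convert h4.mul h5 using 2 with y
      rw [mul_assoc, Finset.mul_prod_erase T (fun b => sin ((y - b) / 2)) haT]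
    · have h1 : SH_LS f x := by
        by_cases hfx : f x = 0
        · rw [hk]
          apply hLSshift
          by_contra hcon
          apply haT
          rw [hT, Finset.mem_filter, memZ]
          exact ⟨⟨ha, by rw [← SH_perk hper k, ← hk, hfx]⟩, hcon⟩
        · exact SH_LS.of_ne hc hfx
      refine h1.mul (SH_LS.of_ne hgc ?_)
      rw [hg]
      refine Finset.prod_ne_zero_iff.mpr fun b hb h0 => ?_
      obtain ⟨l, hl⟩ := SH_sin_zero h0
      have hb2 := memT b hb
      apply hb2.2.2
      have := hLSshift x (-l) h1
      convert this using 1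
      rw [hl]; push_cast; ring
  have hglob := SH_global (hc.mul hgc) hls (fun x => by
    filter_upwards [hisol x] with y hy using mul_ne_zero hy (hg0 y hy))
  have hex : ∃ y ∈ Icc (0:ℝ) (2 * π), f y ≠ 0 := by
    have h2 : ∀ᶠ y in 𝓝[≠] π, y ∈ Icc (0:ℝ) (2 * π) :=
      eventually_nhdsWithin_of_eventually_nhds
        (Icc_mem_nhds pi_pos (by linarith [pi_pos]))
    obtain ⟨y, h3, h4⟩ := (h2.and (hisol π)).exists
    exact ⟨y, h3, h4⟩
  obtain ⟨y, hy, hfy⟩ := hex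
  have hgy := hg0 y hfy
  have hne := mul_ne_zero hfy hgy
  have hshift : g (y + 2 * π) = (-1) ^ T.card * g y := by
    simp only [hg]
    rw [← Finset.prod_const, ← Finset.prod_mul_distrib]
    refine Finset.prod_congr rfl fun a _ => ?_
    have : (y + 2 * π - a) / 2 = (y - a) / 2 + π := by ring
    rw [this, sin_add_pi]; ring
  rcases Nat.even_or_odd T.card with hev | hod
  · obtain ⟨m, hm⟩ := hev
    have hmem := SH_prod_mem T
    rw [hm] at hmem
    have hint := (SH_orth n f hc hcos hsin m (by omega) _ hmem).2
    change (∫ θ in (0:ℝ)..(2 * π), f θ * g θ) = 0 at hint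
    rcases hglob with h | h
    · have := intervalIntegral.integral_pos two_pi_pos (hc.mul hgc).continuousOn
        (fun x _ => h x) ⟨y, hy, lt_of_le_of_ne (h y) (Ne.symm hne)⟩
      exact absurd hint (ne_of_gt this)
    · have := intervalIntegral.integral_pos two_pi_pos (hc.mul hgc).neg.continuousOn
        (fun x _ => neg_nonneg.mpr (h x))
        ⟨y, hy, neg_pos.mpr (lt_of_le_of_ne (h y) hne)⟩
      have h6 : (∫ θ in (0:ℝ)..(2 * π), -(f θ * g θ)) = 0 := by
        rw [intervalIntegral.integral_neg, hint, neg_zero]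
      exact absurd h6 (ne_of_gt this)
  · rw [hod.neg_one_pow] at hshift
    have h2 : f (y + 2 * π) * g (y + 2 * π) = - (f y * g y) := by
      rw [hshift, hper]; ring
    rcases hglob with h | h
    · have h3 := h (y + 2 * π)
      have h4 := h y
      simp only [Pi.mul_apply] at h3 h4
      exact hne (by linarith)
    · have h3 := h (y + 2 * π)
      have h4 := h y
      simp only [Pi.mul_apply] at h3 h4
      exact hne (by linarith)

end

/-- **Sturm–Hurwitz (Tabachnikov) theorem.**  If `f : ℝ → ℝ` is continuous, `2π`-periodic,
not identically zero, and all its Fourier coefficients of order `< n` vanish, then `f` has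
at least `2 * n` distinct zeros in `[0, 2π)`. -/
theorem sturm_hurwitz (n : ℕ) (hn : 1 ≤ n) (f : ℝ → ℝ) (hc : Continuous f)
    (hper : ∀ θ : ℝ, f (θ + 2 * Real.pi) = f θ)
    (hnz : ∃ θ : ℝ, f θ ≠ 0)
    (hcos : ∀ k : ℕ, k < n → (∫ θ in (0:ℝ)..(2 * Real.pi), f θ * Real.cos (k * θ)) = 0)
    (hsin : ∀ k : ℕ, k < n → (∫ θ in (0:ℝ)..(2 * Real.pi), f θ * Real.sin (k * θ)) = 0) :
    ∃ S : Finset ℝ, 2 * n ≤ S.card ∧ ∀ θ ∈ S, θ ∈ Set.Ico (0:ℝ) (2 * Real.pi) ∧ f θ = 0 := by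
  classical
  by_cases hfin : {z | z ∈ Set.Ico (0:ℝ) (2 * Real.pi) ∧ f z = 0}.Finite
  · refine ⟨hfin.toFinset, SH_main n f hc hper hcos hsin hfin, ?_⟩
    intro θ hθ
    simpa using hθ
  · obtain ⟨S, hS, hcard⟩ := Set.Infinite.exists_subset_card_eq hfin (2 * n)
    exact ⟨S, hcard.ge, fun θ hθ => hS hθ⟩
end

section
/- Let f : ℝ → ℝ be continuous with f(θ + 2π) = f(θ) for all θ, let θ₀ ∈ ℝ satisfy f(θ₀) ≠ 0, and suppose the set of zeros of f in [θ₀, θ₀ + 2π) is finite. Then the number of zeros z ∈ [θ₀, θ₀ + 2π) at which f changes sign — i.e. for which there exists δ > 0 such that f is nonzero on (z−δ, z) ∪ (z, z+δ) and f takes values of opposite sign on (z−δ, z) and on (z, z+δ) — is even. -/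
def SgnChg (f : ℝ → ℝ) (z : ℝ) : Prop := ∃ δ > (0:ℝ),
        ((∀ t ∈ Set.Ioo (z - δ) z, f t < 0) ∧ (∀ t ∈ Set.Ioo z (z + δ), 0 < f t)) ∨
        ((∀ t ∈ Set.Ioo (z - δ) z, 0 < f t) ∧ (∀ t ∈ Set.Ioo z (z + δ), f t < 0))

lemma same_sgn (f : ℝ → ℝ) (hc : Continuous f) (x y : ℝ) (hxy : x ≤ y)
    (h : ∀ t, x ≤ t → t ≤ y → f t ≠ 0) : 0 < f x * f y := by
  by_contra hn
  have h1 := intermediate_value_uIcc (f := f) (a := x) (b := y) hc.continuousOn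
  have h2 : (0:ℝ) ∈ Set.uIcc (f x) (f y) := by
    rw [Set.mem_uIcc]
    by_contra hcon
    apply hn
    rcases lt_or_ge (f x) 0 with h3 | h3
    · rcases lt_or_ge (f y) 0 with h4 | h4
      · exact mul_pos_of_neg_of_neg h3 h4
      · exact absurd (Or.inl ⟨h3.le, h4⟩) hcon
    · rcases le_or_gt (f y) 0 with h4 | h4
      · exact absurd (Or.inr ⟨h4, h3⟩) hcon
      · exact mul_pos (lt_of_le_of_ne h3 (h x le_rfl hxy).symm) h4
  obtain ⟨t, ht, h0⟩ := h1 h2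
  rw [Set.uIcc_of_le hxy] at ht
  exact h t ht.1 ht.2 h0

lemma sgnChg_iff (f : ℝ → ℝ) (hc : Continuous f) (c z b : ℝ) (hcz : c < z) (hzb : z < b)
    (h1 : ∀ t, c ≤ t → t < z → f t ≠ 0) (h2 : ∀ t, z < t → t ≤ b → f t ≠ 0) :
    SgnChg f z ↔ f c * f b < 0 := by
  have k1 : ∀ t, c ≤ t → t < z → 0 < f c * f t := fun t h h' =>
    same_sgn f hc c t h (fun u hu hu' => h1 u hu (by linarith))
  have k2 : ∀ t, z < t → t ≤ b → 0 < f t * f b := fun t h h' =>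
    same_sgn f hc t b h' (fun u hu hu' => h2 u (by linarith) hu')
  constructor
  · rintro ⟨δ, hδ, h⟩
    obtain ⟨u, hu, hu'⟩ := exists_between (max_lt hcz (sub_lt_self z hδ))
    obtain ⟨v, hv, hv'⟩ := exists_between (lt_min hzb (lt_add_of_pos_right z hδ))
    rw [max_lt_iff] at hu
    rw [lt_min_iff] at hv'
    have a1 := k1 u hu.1.le hu'
    have a2 := k2 v hv hv'.1.le
    rcases h with ⟨h, h'⟩ | ⟨h, h'⟩
    · have b1 := h u ⟨hu.2, hu'⟩
      have b2 := h' v ⟨hv, hv'.2⟩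
      exact mul_neg_of_neg_of_pos (neg_of_mul_pos_left a1 b1.le) (pos_of_mul_pos_right a2 b2.le)
    · have b1 := h u ⟨hu.2, hu'⟩
      have b2 := h' v ⟨hv, hv'.2⟩
      exact mul_neg_of_pos_of_neg (pos_of_mul_pos_left a1 b1.le) (neg_of_mul_pos_right a2 b2.le)
  · intro h
    refine ⟨min (z - c) (b - z), lt_min (by linarith) (by linarith), ?_⟩
    have m1 := min_le_left (z - c) (b - z)
    have m2 := min_le_right (z - c) (b - z)
    rcases mul_neg_iff.1 h with ⟨p, q⟩ | ⟨p, q⟩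
    · right
      refine ⟨fun t ht => ?_, fun t ht => ?_⟩
      · exact pos_of_mul_pos_right (k1 t (by linarith [ht.1]) ht.2) p.le
      · exact neg_of_mul_pos_left (k2 t ht.1 (by linarith [ht.2])) q.le
    · left
      refine ⟨fun t ht => ?_, fun t ht => ?_⟩
      · exact neg_of_mul_pos_right (k1 t (by linarith [ht.1]) ht.2) p.le
      · exact pos_of_mul_pos_left (k2 t ht.1 (by linarith [ht.2])) q.le

lemma parity (f : ℝ → ℝ) (hc : Continuous f) (a : ℝ) (ha : f a ≠ 0) (Z : Finset ℝ) :
    ∀ b, a ≤ b → f b ≠ 0 → (∀ x, x ∈ Z ↔ a ≤ x ∧ x < b ∧ f x = 0) →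
      (Even {z ∈ Set.Ico a b | f z = 0 ∧ SgnChg f z}.ncard ↔ 0 < f a * f b) := by
  induction Z using Finset.induction_on_max with
  | empty =>
    intro b hab hb hZ
    have h1 : {z ∈ Set.Ico a b | f z = 0 ∧ SgnChg f z} = ∅ := by
      ext x
      have := hZ x
      simp only [Finset.notMem_empty, false_iff] at this
      simp only [Set.mem_ofPred_eq, Set.mem_Ico, Set.mem_empty_iff_false, iff_false]
      tauto
    rw [h1]
    simp only [Set.ncard_empty, Even.zero, true_iff]
    refine same_sgn f hc a b hab (fun t h h' h0 => ?_)
    rcases h'.lt_or_eq with h' | h'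
    · simpa using (hZ t).2 ⟨h, h', h0⟩
    · exact hb (h' ▸ h0)
  | insert z s hs ih =>
    intro b hab hb hZ
    obtain ⟨haz, hzb, hz0⟩ := (hZ z).1 (Finset.mem_insert_self _ _)
    have haz' : a < z := lt_of_le_of_ne haz (fun h => ha (h ▸ hz0))
    have hne : (insert a s).Nonempty := Finset.insert_nonempty _ _
    have hm : (insert a s).max' hne < z := by
      rw [Finset.max'_lt_iff]
      intro y hy
      rcases Finset.mem_insert.1 hy with rfl | hy
      · exact haz'
      · exact hs y hy
    obtain ⟨c, hmc, hcz⟩ := exists_between hm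
    rw [Finset.max'_lt_iff] at hmc
    have hac : a < c := hmc a (Finset.mem_insert_self _ _)
    have hsc : ∀ y ∈ s, y < c := fun y hy => hmc y (Finset.mem_insert_of_mem hy)
    have h1 : ∀ t, c ≤ t → t < z → f t ≠ 0 := by
      intro t h h' h0
      rcases Finset.mem_insert.1 ((hZ t).2 ⟨by linarith, by linarith, h0⟩) with h3 | h3
      · linarith
      · linarith [hsc t h3]
    have h2 : ∀ t, z < t → t ≤ b → f t ≠ 0 := by
      intro t h h' h0
      rcases h'.lt_or_eq with h' | h'
      · rcases Finset.mem_insert.1 ((hZ t).2 ⟨by linarith, h', h0⟩) with h3 | h3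
        · linarith
        · linarith [hs t h3]
      · exact hb (h' ▸ h0)
    have hfc := h1 c le_rfl hcz
    have hs' : ∀ x, x ∈ s ↔ a ≤ x ∧ x < c ∧ f x = 0 := by
      intro x
      constructor
      · intro hx
        have := (hZ x).1 (Finset.mem_insert_of_mem hx)
        exact ⟨this.1, hsc x hx, this.2.2⟩
      · rintro ⟨p, q, r⟩
        rcases Finset.mem_insert.1 ((hZ x).2 ⟨p, by linarith, r⟩) with h3 | h3
        · linarith
        · exact h3
    have IH := ih c hac.le hfc hs'
    have key := sgnChg_iff f hc c z b hcz hzb h1 h2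
    have hfinc : {z ∈ Set.Ico a c | f z = 0 ∧ SgnChg f z}.Finite :=
      s.finite_toSet.subset (fun x hx => (hs' x).2 ⟨hx.1.1, hx.1.2, hx.2.1⟩)
    have hnot : z ∉ {z ∈ Set.Ico a c | f z = 0 ∧ SgnChg f z} := fun h => by
      linarith [h.1.2]
    have hzero : ∀ x, a ≤ x → x < b → f x = 0 → x = z ∨ x < c := by
      intro x p q r
      rcases Finset.mem_insert.1 ((hZ x).2 ⟨p, q, r⟩) with h3 | h3
      · exact Or.inl h3
      · exact Or.inr (hsc x h3)
    by_cases hS : SgnChg f z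
    · have e : {z ∈ Set.Ico a b | f z = 0 ∧ SgnChg f z} =
          insert z {z ∈ Set.Ico a c | f z = 0 ∧ SgnChg f z} := by
        ext x
        simp only [Set.mem_insert_iff, Set.mem_ofPred_eq, Set.mem_Ico]
        constructor
        · rintro ⟨⟨p, q⟩, r, t⟩
          rcases hzero x p q r with h | h
          · exact Or.inl h
          · exact Or.inr ⟨⟨p, h⟩, r, t⟩
        · rintro (rfl | ⟨⟨p, q⟩, r, t⟩)
          · exact ⟨⟨haz, hzb⟩, hz0, hS⟩
          · exact ⟨⟨p, by linarith⟩, r, t⟩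
      rw [e, Set.ncard_insert_of_notMem hnot hfinc, Nat.even_add_one, IH]
      have hcb := key.1 hS
      rw [mul_pos_iff, mul_pos_iff]
      rcases mul_neg_iff.1 hcb with ⟨p, q⟩ | ⟨p, q⟩ <;> rcases lt_or_gt_of_ne ha with r | r <;>
        simp [p, q, r, p.not_gt, q.not_gt, r.not_gt]
    · have e : {z ∈ Set.Ico a b | f z = 0 ∧ SgnChg f z} =
          {z ∈ Set.Ico a c | f z = 0 ∧ SgnChg f z} := by
        ext x
        simp only [Set.mem_ofPred_eq, Set.mem_Ico]
        constructor
        · rintro ⟨⟨p, q⟩, r, t⟩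
          rcases hzero x p q r with h | h
          · exact absurd (h ▸ t) hS
          · exact ⟨⟨p, h⟩, r, t⟩
        · rintro ⟨⟨p, q⟩, r, t⟩
          exact ⟨⟨p, by linarith⟩, r, t⟩
      rw [e, IH]
      have hcb : 0 < f c * f b :=
        lt_of_le_of_ne (not_lt.1 (fun h => hS (key.2 h))) (mul_ne_zero hfc hb).symm
      rw [mul_pos_iff, mul_pos_iff]
      rcases mul_pos_iff.1 hcb with ⟨p, q⟩ | ⟨p, q⟩ <;> rcases lt_or_gt_of_ne ha with r | r <;>
        simp [p, q, r, p.not_gt, q.not_gt, r.not_gt]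

/-- A continuous `2π`-periodic function that is nonzero at some point `θ₀` and has finitely
many zeros in the period `[θ₀, θ₀ + 2π)` has an **even** number of zeros in that period at
which it changes sign. -/
theorem even_number_of_sign_change_zeros (f : ℝ → ℝ) (hc : Continuous f)
    (hper : ∀ θ : ℝ, f (θ + 2 * Real.pi) = f θ)
    (θ₀ : ℝ) (h0 : f θ₀ ≠ 0)
    (hfin : {z ∈ Set.Ico θ₀ (θ₀ + 2 * Real.pi) | f z = 0}.Finite) :
    Even {z ∈ Set.Ico θ₀ (θ₀ + 2 * Real.pi) | f z = 0 ∧ ∃ δ > (0:ℝ),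
        ((∀ t ∈ Set.Ioo (z - δ) z, f t < 0) ∧ (∀ t ∈ Set.Ioo z (z + δ), 0 < f t)) ∨
        ((∀ t ∈ Set.Ioo (z - δ) z, 0 < f t) ∧ (∀ t ∈ Set.Ioo z (z + δ), f t < 0))}.ncard := by
  refine (parity f hc θ₀ h0 hfin.toFinset (θ₀ + 2 * Real.pi)
    (by linarith [Real.pi_pos]) (by rwa [hper]) (fun x => ?_)).2 ?_
  · simp [and_assoc]
  · rw [hper]
    exact mul_self_pos.2 h0
end

section
/- Let H₀ and H₁ be N×N complex Hermitian matrices, θ ∈ ℝ, and let z ∈ ℂ^N be nonzero. If (H₀·cos θ + H₁·sin θ) z = λ z and (−H₀·sin θ + H₁·cos θ) z = μ z for some scalars λ and μ, then (H₀H₁ − H₁H₀) z = 0, i.e. z lies in the kernel of the commutator [H₀, H₁]. -/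
/-- If a nonzero vector `z` is a simultaneous eigenvector of
`H_θ = H₀ cos θ + H₁ sin θ` and of `H_θ' = −H₀ sin θ + H₁ cos θ`, then `z` lies in the
kernel of the commutator `[H₀, H₁] = H₀H₁ − H₁H₀`. -/
theorem commutator_kernel_of_simultaneous_eigenvector
    (N : ℕ) (H₀ H₁ : Matrix (Fin N) (Fin N) ℂ)
    (h₀ : H₀.IsHermitian) (h₁ : H₁.IsHermitian)
    (θ : ℝ) (z : Fin N → ℂ) (hz : z ≠ 0) (lam mu : ℂ)
    (h1 : ((Real.cos θ : ℂ) • H₀ + (Real.sin θ : ℂ) • H₁).mulVec z = lam • z)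
    (h2 : ((-(Real.sin θ) : ℂ) • H₀ + (Real.cos θ : ℂ) • H₁).mulVec z = mu • z) :
    (H₀ * H₁ - H₁ * H₀).mulVec z = 0 := by
  have hcs : (Real.cos θ : ℂ) * (Real.cos θ : ℂ) + (Real.sin θ : ℂ) * (Real.sin θ : ℂ) = 1 := by
    have h := Real.cos_sq_add_sin_sq θ
    rw [pow_two, pow_two] at h
    exact_mod_cast h
  generalize (Real.cos θ : ℂ) = c at *
  generalize (Real.sin θ : ℂ) = s at *
  have key : H₀ * H₁ - H₁ * H₀ =
      (c • H₀ + s • H₁) * (-s • H₀ + c • H₁) - (-s • H₀ + c • H₁) * (c • H₀ + s • H₁) := by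
    have e : (c • H₀ + s • H₁) * (-s • H₀ + c • H₁) - (-s • H₀ + c • H₁) * (c • H₀ + s • H₁)
        = (c * c + s * s) • (H₀ * H₁ - H₁ * H₀) := by
      simp only [add_mul, mul_add, smul_mul_assoc, mul_smul_comm]
      module
    rw [e, hcs, one_smul]
  rw [key, Matrix.sub_mulVec, ← Matrix.mulVec_mulVec, ← Matrix.mulVec_mulVec, h1, h2,
    Matrix.mulVec_smul, Matrix.mulVec_smul, h1, h2, smul_comm, sub_self]
end

section
/- Let H₀ and H₁ be N×N complex Hermitian matrices, θ ∈ ℝ, λ a scalar, and z ∈ ℂ^N. If (H₀H₁ − H₁H₀) z = 0 and (H₀·cos θ + H₁·sin θ) z = λ z, then (H₀·cos θ + H₁·sin θ)·((−H₀·sin θ + H₁·cos θ) z) = λ·((−H₀·sin θ + H₁·cos θ) z); equivalently (λI − H_θ)·H_θ' z = 0, so H_θ' z lies in the λ-eigenspace of H_θ. -/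
/-- If `[H₀, H₁] z = 0` and `H_θ z = λ z` for `H_θ = H₀ cos θ + H₁ sin θ`, then
`H_θ' z = (−H₀ sin θ + H₁ cos θ) z` again lies in the `λ`-eigenspace of `H_θ`. -/
theorem commutator_zero_eigenvector_invariance
    (N : ℕ) (H₀ H₁ : Matrix (Fin N) (Fin N) ℂ)
    (h₀ : H₀.IsHermitian) (h₁ : H₁.IsHermitian)
    (θ : ℝ) (lam : ℂ) (z : Fin N → ℂ)
    (hcomm : (H₀ * H₁ - H₁ * H₀).mulVec z = 0)
    (heig : ((Real.cos θ : ℂ) • H₀ + (Real.sin θ : ℂ) • H₁).mulVec z = lam • z) :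
    ((Real.cos θ : ℂ) • H₀ + (Real.sin θ : ℂ) • H₁).mulVec
        (((-(Real.sin θ) : ℂ) • H₀ + (Real.cos θ : ℂ) • H₁).mulVec z)
      = lam • (((-(Real.sin θ) : ℂ) • H₀ + (Real.cos θ : ℂ) • H₁).mulVec z) := by
  generalize (Real.cos θ : ℂ) = c at *
  generalize (Real.sin θ : ℂ) = s at *
  have key : (c • H₀ + s • H₁) * ((-s) • H₀ + c • H₁)
      = ((-s) • H₀ + c • H₁) * (c • H₀ + s • H₁)
        + (c * c + s * s) • (H₀ * H₁ - H₁ * H₀) := by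
    simp only [add_mul, mul_add, smul_mul_assoc, mul_smul_comm, smul_smul]
    module
  rw [Matrix.mulVec_mulVec, key, Matrix.add_mulVec, Matrix.smul_mulVec, hcomm,
    smul_zero, add_zero, ← Matrix.mulVec_mulVec, heig, Matrix.mulVec_smul]
end

section
/- Let a and b be unit vectors in ℂ^N whose inner product ⟨a, b⟩ = t is real, let H₀ z := z − ⟨a, z⟩ a, H₁ z := z − ⟨b, z⟩ b, and H := H₀·cos(5π/4) + H₁·sin(5π/4). Then H (a + b) = −(√2/2)(1 − t) · (a + b) and H (a − b) = −(√2/2)(1 + t) · (a − b); moreover both numbers −(√2/2)(1 ∓ t) are ≥ −√2, and −(√2/2)(1 + t) = −√2 forces a = b. -/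
open scoped InnerProductSpace

/-- `H₀ z = z − ⟨a, z⟩ a`, the Grover projector Hamiltonian `I − |a⟩⟨a|`. -/
noncomputable def grovProj {N : ℕ} (a : EuclideanSpace ℂ (Fin N)) (z : EuclideanSpace ℂ (Fin N)) :
    EuclideanSpace ℂ (Fin N) :=
  z - ⟪a, z⟫_ℂ • a

/-- `H = H₀ cos (5π/4) + H₁ sin (5π/4)` for the Grover Hamiltonians
`H₀ = I − |a⟩⟨a|`, `H₁ = I − |b⟩⟨b|`. -/
noncomputable def grovH {N : ℕ} (a b : EuclideanSpace ℂ (Fin N)) (z : EuclideanSpace ℂ (Fin N)) :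
    EuclideanSpace ℂ (Fin N) :=
  Real.cos (5 * Real.pi / 4) • grovProj a z + Real.sin (5 * Real.pi / 4) • grovProj b z

/-- On `span{a, b}`, the Grover Hamiltonian `H_{5π/4}` has eigenvectors `a ± b` with
eigenvalues `−(√2/2)(1 ∓ t)` where `t = ⟨a, b⟩ ∈ ℝ`; both eigenvalues are `≥ −√2`, and
`−(√2/2)(1 + t) = −√2` forces `a = b`. -/
theorem grover_span_eigenvalues {N : ℕ} (a b : EuclideanSpace ℂ (Fin N))
    (ha : ‖a‖ = 1) (hb : ‖b‖ = 1) (t : ℝ) (hab : ⟪a, b⟫_ℂ = (t : ℂ)) :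
    grovH a b (a + b) = (-(Real.sqrt 2 / 2) * (1 - t)) • (a + b) ∧
    grovH a b (a - b) = (-(Real.sqrt 2 / 2) * (1 + t)) • (a - b) ∧
    -Real.sqrt 2 ≤ -(Real.sqrt 2 / 2) * (1 - t) ∧
    -Real.sqrt 2 ≤ -(Real.sqrt 2 / 2) * (1 + t) ∧
    (-(Real.sqrt 2 / 2) * (1 + t) = -Real.sqrt 2 → a = b) := by
  have hcos : Real.cos (5 * Real.pi / 4) = -(Real.sqrt 2 / 2) := by
    rw [show 5 * Real.pi / 4 = Real.pi / 4 + Real.pi by ring, Real.cos_add_pi,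
      Real.cos_pi_div_four]
  have hsin : Real.sin (5 * Real.pi / 4) = -(Real.sqrt 2 / 2) := by
    rw [show 5 * Real.pi / 4 = Real.pi / 4 + Real.pi by ring, Real.sin_add_pi,
      Real.sin_pi_div_four]
  have haa : ⟪a, a⟫_ℂ = 1 := by
    rw [inner_self_eq_norm_sq_to_K, ha]; simp
  have hbb : ⟪b, b⟫_ℂ = 1 := by
    rw [inner_self_eq_norm_sq_to_K, hb]; simp
  have hba : ⟪b, a⟫_ℂ = (t : ℂ) := by
    rw [← inner_conj_symm, hab, Complex.conj_ofReal]
  have hs : 0 < Real.sqrt 2 := by positivity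
  have ht : |t| ≤ 1 := by
    have h := norm_inner_le_norm (𝕜 := ℂ) a b
    rw [hab, ha, hb, Complex.norm_real] at h
    simpa using h
  obtain ⟨h1, h2⟩ := abs_le.mp ht
  refine ⟨?_, ?_, by nlinarith, by nlinarith, ?_⟩
  · simp only [grovH, grovProj, hcos, hsin, inner_add_right, haa, hab, hba, hbb]
    ext i
    simp
    ring
  · simp only [grovH, grovProj, hcos, hsin, inner_sub_right, haa, hab, hba, hbb]
    ext i
    simp
    ring
  · intro h
    have ht1 : t = 1 := by
      have h3 : Real.sqrt 2 * (t - 1) = 0 := by linarith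
      rcases mul_eq_zero.mp h3 with h4 | h4
      · exact absurd h4 hs.ne'
      · linarith
    refine (inner_eq_one_iff_of_norm_eq_one (𝕜 := ℂ) ha hb).mp ?_
    rw [hab, ht1]; simp
end

section
/- Let H₀ and H₁ be N×N complex Hermitian matrices with N ≥ 1, and define f : ℝ → ℝ by f(θ) := the smallest eigenvalue of H_θ := H₀·cos θ + H₁·sin θ, equivalently f(θ) = inf{⟨z, H_θ z⟩ : z ∈ ℂ^N, ‖z‖ = 1}. Suppose f is differentiable on a neighborhood of θ₀ and its derivative f' is differentiable at θ₀. Then f(θ₀) + f''(θ₀) ≤ 0. -/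
open scoped Matrix

lemma aux_bdd (N : ℕ) (M : Matrix (Fin N) (Fin N) ℂ) (z : Fin N → ℂ)
    (hz : (∑ i, ‖z i‖ ^ 2) = 1) : -(∑ i, ∑ j, ‖M i j‖) ≤ (star z ⬝ᵥ M.mulVec z).re := by
  have h1 : ∀ i, ‖z i‖ ≤ 1 := by
    intro i
    have h := Finset.single_le_sum (f := fun i => ‖z i‖ ^ 2) (fun i _ => sq_nonneg _)
      (Finset.mem_univ i)
    simp only [hz] at h
    nlinarith [norm_nonneg (z i)]
  have h2 : ‖star z ⬝ᵥ M.mulVec z‖ ≤ ∑ i, ∑ j, ‖M i j‖ := by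
    simp only [dotProduct, Matrix.mulVec]
    refine (norm_sum_le _ _).trans (Finset.sum_le_sum fun i _ => ?_)
    rw [norm_mul, Pi.star_apply, norm_star]
    refine (mul_le_of_le_one_left (norm_nonneg _) (h1 i)).trans ?_
    refine (norm_sum_le _ _).trans (Finset.sum_le_sum fun j _ => ?_)
    rw [norm_mul]
    exact mul_le_of_le_one_right (norm_nonneg _) (h1 j)
  have h3 := Complex.abs_re_le_norm (star z ⬝ᵥ M.mulVec z)
  linarith [neg_abs_le (star z ⬝ᵥ M.mulVec z).re]

lemma aux_calc (f f' : ℝ → ℝ) (θ₀ δ : ℝ) (hδ : 0 < δ)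
    (hsym : ∀ h, 0 < Real.cos h → f (θ₀ + h) + f (θ₀ - h) ≤ 2 * Real.cos h * f θ₀)
    (hf' : ∀ t ∈ Set.Ioo (θ₀ - δ) (θ₀ + δ), HasDerivAt f (f' t) t)
    (c : ℝ) (hf'' : HasDerivAt f' c θ₀) : f θ₀ + c ≤ 0 := by
  by_contra! hc
  set G : ℝ → ℝ := fun h => f (θ₀ + h) + f (θ₀ - h) - 2 * Real.cos h * f θ₀ with hG
  set G' : ℝ → ℝ := fun h => f' (θ₀ + h) - f' (θ₀ - h) + 2 * Real.sin h * f θ₀ with hG'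
  have hd : ∀ h ∈ Set.Ioo (-δ) δ, HasDerivAt G (G' h) h := by
    intro h hh
    have a := (hf' (θ₀ + h) ⟨by linarith [hh.1], by linarith [hh.2]⟩).comp_const_add θ₀ h
    have b := (hf' (θ₀ - h) ⟨by linarith [hh.2], by linarith [hh.1]⟩).comp_const_sub θ₀ h
    have e := ((Real.hasDerivAt_cos h).const_mul 2).mul_const (f θ₀)
    refine ((a.add b).sub e).congr_deriv ?_
    simp only [hG']; ring
  have hev : deriv G =ᶠ[nhds 0] G' := by
    filter_upwards [Ioo_mem_nhds (neg_lt_zero.2 hδ) hδ] with h hh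
    exact (hd h hh).deriv
  have hd2 : HasDerivAt G' (2 * (f θ₀ + c)) 0 := by
    have a := HasDerivAt.comp_const_add (f := f') θ₀ 0 (by simpa using hf'')
    have b := HasDerivAt.comp_const_sub (f := f') θ₀ 0 (by simpa using hf'')
    have e := ((Real.hasDerivAt_sin 0).const_mul 2).mul_const (f θ₀)
    refine ((a.sub b).add e).congr_deriv ?_
    simp; ring
  have hdd : deriv (deriv G) 0 = 2 * (f θ₀ + c) := by
    rw [hev.deriv_eq, hd2.deriv]
  have h0 : deriv G 0 = 0 := by
    rw [hev.eq_of_nhds]; simp [hG']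
  have hmin : IsLocalMin G 0 := isLocalMin_of_deriv_deriv_pos (by rw [hdd]; linarith) h0
    (hd 0 ⟨by linarith, hδ⟩).continuousAt
  have hG0 : G 0 = 0 := by simp [hG]; ring
  have hcos : ∀ᶠ h in nhds (0 : ℝ), 0 < Real.cos h :=
    Real.continuous_cos.continuousAt.eventually_mem (Ioi_mem_nhds (by simp))
  have hconst : G =ᶠ[nhds 0] fun _ => (0 : ℝ) := by
    filter_upwards [hmin, hcos] with h h1 h2
    have := hsym h h2
    rw [hG0] at h1
    refine le_antisymm ?_ h1
    simp only [hG]; linarith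
  have h3 : deriv (deriv G) 0 = 0 := by
    rw [hconst.deriv.deriv_eq]; simp
  rw [hdd] at h3
  linarith

/-- For the ground level `f(θ) = λ₁(H₀ cos θ + H₁ sin θ)`, given as the infimum of the
quadratic form over unit vectors, the curvature quantity satisfies
`f(θ₀) + f''(θ₀) ≤ 0` wherever `f` is twice differentiable (convexity of the boundary of
the numerical range of `H₀ + i H₁`). -/
theorem ground_level_plus_second_derivative_nonpos
    (N : ℕ) (hN : 1 ≤ N) (H₀ H₁ : Matrix (Fin N) (Fin N) ℂ)
    (h₀ : H₀.IsHermitian) (h₁ : H₁.IsHermitian)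
    (f f' : ℝ → ℝ)
    (hf : ∀ θ : ℝ, f θ = sInf {r : ℝ | ∃ z : Fin N → ℂ, (∑ i, ‖z i‖ ^ 2) = 1 ∧
        r = (star z ⬝ᵥ ((Real.cos θ : ℂ) • H₀ + (Real.sin θ : ℂ) • H₁).mulVec z).re})
    (θ₀ : ℝ) (δ : ℝ) (hδ : 0 < δ)
    (hf' : ∀ t ∈ Set.Ioo (θ₀ - δ) (θ₀ + δ), HasDerivAt f (f' t) t)
    (f''₀ : ℝ) (hf'' : HasDerivAt f' f''₀ θ₀) :
    f θ₀ + f''₀ ≤ 0 := by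
  refine aux_calc f f' θ₀ δ hδ ?_ hf' f''₀ hf''
  intro h hh
  have hle : ∀ θ (z : Fin N → ℂ), (∑ i, ‖z i‖ ^ 2) = 1 → f θ ≤
      Real.cos θ * (star z ⬝ᵥ H₀.mulVec z).re + Real.sin θ * (star z ⬝ᵥ H₁.mulVec z).re := by
    intro θ z hz
    rw [hf θ]
    refine csInf_le ⟨?_, ?_⟩ ⟨z, hz, ?_⟩
    · exact -(∑ i, ∑ j, ‖((Real.cos θ : ℂ) • H₀ + (Real.sin θ : ℂ) • H₁) i j‖)
    · rintro r ⟨w, hw, rfl⟩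
      exact aux_bdd N _ w hw
    · simp only [Matrix.add_mulVec, Matrix.smul_mulVec, dotProduct_add, dotProduct_smul,
        smul_eq_mul, Complex.add_re, Complex.re_ofReal_mul]
  have key : (f (θ₀ + h) + f (θ₀ - h)) / (2 * Real.cos h) ≤ f θ₀ := by
    rw [hf θ₀]
    refine le_csInf ?_ ?_
    · refine ⟨_, Pi.single ⟨0, hN⟩ 1, ?_, rfl⟩
      rw [Finset.sum_eq_single ⟨0, hN⟩] <;> simp +contextual [Pi.single_apply]
    · rintro r ⟨z, hz, rfl⟩
      rw [div_le_iff₀ (by positivity)]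
      simp only [Matrix.add_mulVec, Matrix.smul_mulVec, dotProduct_add, dotProduct_smul,
        smul_eq_mul, Complex.add_re, Complex.re_ofReal_mul]
      have a := hle (θ₀ + h) z hz
      have b := hle (θ₀ - h) z hz
      rw [Real.cos_add, Real.sin_add] at a
      rw [Real.cos_sub, Real.sin_sub] at b
      linarith
  rw [div_le_iff₀ (by positivity)] at key
  linarith
end
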